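/- For all integers n ≥ 2, the prime counting function satisfies π(n) ≥ (1/2)·(n / log n) − 1/2, where π(n) denotes the number of primes ≤ n. -/

import Mathlib

/-- Chebyshev-type lower bound: for all `n ≥ 2`, `π(n) ≥ (1/2)·n/log n − 1/2`. -/
theorem primeCounting_lower_bound (n : ℕ) (hn : 2 ≤ n) :
    (1 / 2) * ((n : ℝ) / Real.log n) - 1 / 2 ≤ (Nat.primeCounting n : ℝ) := by
  have hlog : 0 < Real.log n := Real.log_pos (by exact_mod_cast hn)
  have h2 := Real.log_two_gt_d9
  suffices h : (n : ℝ) ≤ (2 * Nat.primeCounting n + 1) * Real.log n by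
    have := (div_le_iff₀ hlog).2 h
    linarith
  rcases lt_or_ge n 6 with hn6 | hn6
  · have hmono : Real.log 2 ≤ Real.log n :=
      Real.log_le_log (by norm_num) (by exact_mod_cast hn)
    interval_cases n
    · have : Nat.primeCounting 2 = 1 := by decide
      rw [this]; push_cast at *; linarith
    · have : Nat.primeCounting 3 = 2 := by decide
      rw [this]; push_cast at *; linarith
    · have : Nat.primeCounting 4 = 2 := by decide
      have h4 : Real.log 4 = 2 * Real.log 2 := by
        rw [show (4 : ℝ) = 2 ^ 2 by norm_num, Real.log_pow]; norm_num
      rw [this]; push_cast at *; linarith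
    · have : Nat.primeCounting 5 = 3 := by decide
      have h4 : 2 * Real.log 2 ≤ Real.log 5 := by
        rw [← Real.log_rpow (by norm_num)]
        exact Real.log_le_log (by norm_num) (by norm_num)
      rw [this]; push_cast at *; linarith
  · have hn6' : (6 : ℝ) ≤ n := by exact_mod_cast hn6
    have hn0 : (0 : ℝ) < n := by linarith
    have hψ := (div_le_iff₀ hlog).1 (Chebyshev.pi_ge n)
    -- The tangent line of `log` at `8` bounds `log ((n + 1) ^ 2 / n)`.
    have htan := Real.log_le_sub_one_of_pos (x := ((n : ℝ) + 1) ^ 2 / n / 2 ^ 3) (by positivity)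
    rw [Real.log_div (by positivity) (by positivity), Real.log_div (by positivity) (by positivity),
      Real.log_pow, Real.log_pow] at htan
    have hx : ((n : ℝ) + 1) ^ 2 / n ≤ n + 2 + 1 / 6 := by
      rw [div_le_iff₀ hn0]; nlinarith
    have hlin : 6 * (Real.log 2 - 0.6) ≤ n * (Real.log 2 - 0.6) :=
      mul_le_mul_of_nonneg_right hn6' (by linarith)
    push_cast at htan
    linarith
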